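/- Let M be a Lie subalgebra of L of codimension one. Then either i(M) = i(L) + 1 or i(M) = i(L) − 1. -/

import Mathlib

open Module

noncomputable section

variable (k : Type*) [Field k]

/-- `L(f) = {x ∈ L | f ⁅x, y⁆ = 0 for all y ∈ L}`. -/
def lieStab (L : Type*) [LieRing L] [LieAlgebra k L] (f : Module.Dual k L) :
    Submodule k L where
  carrier := {x | ∀ y : L, f ⁅x, y⁆ = 0}
  add_mem' := fun {a b} ha hb y => by rw [add_lie, map_add, ha y, hb y, add_zero]
  zero_mem' := fun y => by rw [zero_lie, map_zero]
  smul_mem' := fun c a ha y => by rw [smul_lie, map_smul, ha y, smul_zero]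

/-- The index `i(L)`, the minimum of `dim L(f)` over all `f ∈ L*`. -/
def lieIndex (L : Type*) [LieRing L] [LieAlgebra k L] : ℕ :=
  ⨅ f : Module.Dual k L, finrank k (lieStab k L f)

/-- `f ∈ L*` is regular if `dim L(f) = i(L)`. -/
def LieIsRegular (L : Type*) [LieRing L] [LieAlgebra k L] (f : Module.Dual k L) : Prop :=
  finrank k (lieStab k L f) = lieIndex k L

/-- A commutative polarization of `L`: an abelian Lie subalgebra `P` with
`2 dim P = dim L + i(L)`. -/
def IsCP (L : Type*) [LieRing L] [LieAlgebra k L] (P : LieSubalgebra k L) : Prop :=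
  IsLieAbelian ↥P ∧ 2 * finrank k ↥P = finrank k L + lieIndex k L

/-- A CP-ideal of `L`: a CP which is also a Lie ideal of `L`. -/
def IsCPIdeal (L : Type*) [LieRing L] [LieAlgebra k L] (P : LieSubalgebra k L) : Prop :=
  IsCP k L P ∧ ∀ x y : L, y ∈ P → ⁅x, y⁆ ∈ P

/-- `L` is square integrable if `i(L) = dim Z(L)`. -/
def SquareIntegrable (L : Type*) [LieRing L] [LieAlgebra k L] : Prop :=
  lieIndex k L = finrank k ↥(LieAlgebra.center k L)


namespace LinearMap.BilinForm

variable {k}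
variable {V : Type*} [AddCommGroup V] [Module k V]

theorem map_ker_restrict {B : LinearMap.BilinForm k V} (hB : B.IsAlt) (W : Submodule k V) :
    (LinearMap.ker (B.restrict W)).map W.subtype = W ⊓ B.orthogonal W := by
  ext x
  constructor
  · rintro ⟨w, hw, rfl⟩
    exact ⟨w.2, fun n hn => hB.isRefl _ _ (LinearMap.congr_fun hw ⟨n, hn⟩)⟩
  · rintro ⟨hx, hxo⟩
    exact ⟨⟨x, hx⟩, LinearMap.ext fun n => hB.isRefl _ _ (hxo n n.2), rfl⟩

theorem mem_ker_of_mem_orthogonal {B : LinearMap.BilinForm k V} (hB : B.IsAlt)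
    {W : Submodule k V} {x : V} (hx : x ∈ B.orthogonal W) {R : Submodule k V} (hWR : W ⊔ R = ⊤)
    (hR : ∀ r ∈ R, B r x = 0) : x ∈ LinearMap.ker B := by
  refine LinearMap.ext fun y => hB.isRefl _ _ ?_
  obtain ⟨w, hw, r, hr, rfl⟩ := Submodule.mem_sup.1 (hWR ▸ Submodule.mem_top : y ∈ W ⊔ R)
  rw [map_add, LinearMap.add_apply, hx w hw, hR r hr, add_zero]

variable [FiniteDimensional k V]

theorem _root_.Submodule.sup_eq_top_of_finrank_add_one {W : Submodule k V}
    (hW : finrank k W + 1 = finrank k V) {R : Submodule k V} (hR : ¬ R ≤ W) : W ⊔ R = ⊤ := by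
  apply Submodule.eq_top_of_finrank_eq
  have hlt := Submodule.finrank_lt_finrank_of_lt (left_lt_sup.2 hR)
  have hle := (W ⊔ R).finrank_le
  omega

/-- Restricting an alternating form to a hyperplane changes the dimension of its radical by
exactly one. -/
theorem finrank_ker_restrict_of_finrank_add_one {B : LinearMap.BilinForm k V} (hB : B.IsAlt)
    {W : Submodule k V} (hW : finrank k W + 1 = finrank k V) :
    finrank k (LinearMap.ker (B.restrict W)) = finrank k (LinearMap.ker B) + 1 ∨
      finrank k (LinearMap.ker (B.restrict W)) + 1 = finrank k (LinearMap.ker B) := by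
  rw [← Submodule.finrank_map_subtype_eq, map_ker_restrict hB]
  by_cases hR : LinearMap.ker B ≤ W
  · left
    have hO : B.orthogonal W ≤ W := by
      intro u hu
      by_contra huW
      refine huW (hR (mem_ker_of_mem_orthogonal hB hu (R := k ∙ u)
        (Submodule.sup_eq_top_of_finrank_add_one hW (by simpa using huW)) ?_))
      intro r hr
      obtain ⟨c, rfl⟩ := Submodule.mem_span_singleton.1 hr
      rw [map_smul, LinearMap.smul_apply, hB.self_eq_zero, smul_zero]
    have h := finrank_add_finrank_orthogonal' (B := B) W
    rw [inf_eq_right.2 hR] at h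
    rw [inf_eq_right.2 hO]
    omega
  · right
    have htop := Submodule.sup_eq_top_of_finrank_add_one hW hR
    have hinf : W ⊓ B.orthogonal W = W ⊓ LinearMap.ker B := by
      refine le_antisymm (fun x hx => ⟨hx.1, mem_ker_of_mem_orthogonal hB hx.2 htop
        fun r hr => LinearMap.congr_fun hr x⟩) (fun x hx => ⟨hx.1, fun n _ => ?_⟩)
      exact hB.isRefl _ _ (LinearMap.congr_fun hx.2 n)
    have h := Submodule.finrank_sup_add_finrank_inf_eq W (LinearMap.ker B)
    rw [htop, finrank_top] at h
    rw [hinf]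
    omega

/-- The radical of an alternating form has even codimension. -/
theorem IsAlt.finrank_ker_mod_two {V : Type*} [AddCommGroup V] [Module k V]
    [FiniteDimensional k V] {B : LinearMap.BilinForm k V} (hB : B.IsAlt) :
    finrank k (LinearMap.ker B) % 2 = finrank k V % 2 := by
  induction h : finrank k V generalizing V with
  | zero =>
    have hle := (LinearMap.ker B).finrank_le
    omega
  | succ n ih =>
    have : Nontrivial V := Module.nontrivial_of_finrank_pos (R := k) (by omega)
    obtain ⟨f, hf⟩ := exists_ne (0 : Module.Dual k V)
    have hW := Module.Dual.finrank_ker_add_one_of_ne_zero hf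
    have hn := ih (B := B.restrict (LinearMap.ker f)) (fun x => hB x) (by omega)
    rcases finrank_ker_restrict_of_finrank_add_one hB hW with h' | h' <;> omega

end LinearMap.BilinForm

section

variable {k} {L : Type*} [LieRing L] [LieAlgebra k L]

/-- The alternating form `(x, y) ↦ f ⁅x, y⁆` attached to a functional `f` on a Lie algebra. -/
def lieForm (f : Module.Dual k L) : LinearMap.BilinForm k L :=
  (LieModule.toEnd k L L : L →ₗ[k] Module.End k L).compr₂ f

theorem lieForm_isAlt (f : Module.Dual k L) : (lieForm f).IsAlt := fun x => by
  simp [lieForm]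

theorem ker_lieForm (f : Module.Dual k L) : LinearMap.ker (lieForm f) = lieStab k L f := by
  ext x
  exact LinearMap.ext_iff

theorem ker_restrict_lieForm (M : LieSubalgebra k L) (f : Module.Dual k L) :
    LinearMap.ker ((lieForm f).restrict M.toSubmodule) =
      lieStab k M (f ∘ₗ M.toSubmodule.subtype) := by
  ext x
  exact LinearMap.ext_iff

theorem lieIndex_le (f : Module.Dual k L) : lieIndex k L ≤ finrank k (lieStab k L f) :=
  ciInf_le (OrderBot.bddBelow _) f

theorem exists_lieIsRegular : ∃ f : Module.Dual k L, LieIsRegular k L f :=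
  ciInf_mem fun f : Module.Dual k L => finrank k (lieStab k L f)

theorem lieIndex_mod_two [FiniteDimensional k L] :
    lieIndex k L % 2 = finrank k L % 2 := by
  obtain ⟨f, hf⟩ := exists_lieIsRegular (k := k) (L := L)
  rw [← hf, ← ker_lieForm]
  exact (lieForm_isAlt f).finrank_ker_mod_two

theorem finrank_lieStab_of_finrank_add_one [FiniteDimensional k L] {M : LieSubalgebra k L}
    (hM : finrank k M + 1 = finrank k L) (f : Module.Dual k L) :
    finrank k (lieStab k M (f ∘ₗ M.toSubmodule.subtype)) = finrank k (lieStab k L f) + 1 ∨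
      finrank k (lieStab k M (f ∘ₗ M.toSubmodule.subtype)) + 1 = finrank k (lieStab k L f) := by
  rw [← ker_restrict_lieForm, ← ker_lieForm]
  exact LinearMap.BilinForm.finrank_ker_restrict_of_finrank_add_one (lieForm_isAlt f) hM

end

/-- **Proposition 1.6 (1).** If `M` is a Lie subalgebra of `L` of codimension one, then
either `i(M) = i(L) + 1` or `i(M) = i(L) - 1`. -/
theorem index_codim_one {k L : Type*} [Field k] [CharZero k] [LieRing L]
    [LieAlgebra k L] [FiniteDimensional k L] (M : LieSubalgebra k L)
    (hM : finrank k ↥M + 1 = finrank k L) :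
    lieIndex k ↥M = lieIndex k L + 1 ∨ lieIndex k ↥M + 1 = lieIndex k L := by
  obtain ⟨f, hf⟩ := exists_lieIsRegular (k := k) (L := L)
  obtain ⟨g, hg⟩ := exists_lieIsRegular (k := k) (L := M)
  obtain ⟨g', rfl⟩ := LinearMap.exists_extend (p := M.toSubmodule) g
  unfold LieIsRegular at hf hg
  have hLf := finrank_lieStab_of_finrank_add_one hM f
  have hLg := finrank_lieStab_of_finrank_add_one hM g'
  have hMf := lieIndex_le (f ∘ₗ M.toSubmodule.subtype : Module.Dual k M)
  have hg' := lieIndex_le g'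
  have hL := lieIndex_mod_two (k := k) (L := L)
  have hM' := lieIndex_mod_two (k := k) (L := M)
  omega

end
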